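/- Fix q ∈ ℕ and 0 < ε < δ. There exists C > 0 such that the following holds: for every m ∈ M, every η ∈ C_c^∞((−δ,δ)) with ‖η‖_{C^q} ≤ 1, every a,b,c ∈ ℝ with |a| ≤ ε and |b| ≤ ε, setting m̃ = φ_c^Z(φ_b^W(φ_a^V(m))) and η̃(t) = e^{−2πiNK(c+at)}·η(t), one has |ℓ_{η,m}(h) − ℓ_{η̃,m̃}(h)| ≤ C·ε·‖h‖_{1,q−1} for all h ∈ C^∞_N. -/

import Mathlib

open MeasureTheory Filter Asymptotics

noncomputable section

/-- The Heisenberg group `ℍ`: `ℝ³` with the polarised group law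
`(x,y,z) * (x',y',z') = (x+x', y+y', z+z'+x·y')`. -/
abbrev Heis : Type := ℝ × ℝ × ℝ

/-- The group law of the Heisenberg group. -/
def hmul (g g' : Heis) : Heis :=
  (g.1 + g'.1, g.2.1 + g'.2.1, g.2.2 + g'.2.2 + g.1 * g'.2.1)

/-- The Lie bracket on the Lie algebra `ℝ³` of the Heisenberg group. -/
def hbracket (v w : ℝ × ℝ × ℝ) : ℝ × ℝ × ℝ :=
  (0, 0, v.1 * w.2.1 - w.1 * v.2.1)

/-- The exponential map of the Heisenberg group. -/
def hexp (v : ℝ × ℝ × ℝ) : Heis := (v.1, v.2.1, v.2.2 + v.1 * v.2.1 / 2)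

/-- The inverse of the exponential map. -/
def hlog (g : Heis) : ℝ × ℝ × ℝ := (g.1, g.2.1, g.2.2 - g.1 * g.2.1 / 2)

/-- The basis element `X` of the Lie algebra. -/
def Xvec : ℝ × ℝ × ℝ := (1, 0, 0)

/-- The basis element `Y` of the Lie algebra. -/
def Yvec : ℝ × ℝ × ℝ := (0, 1, 0)

/-- The central element `Z` of the Lie algebra. -/
def Zvec : ℝ × ℝ × ℝ := (0, 0, 1)

/-- The lattice `Γ_K = {(x, y, z/K) : x,y,z ∈ ℤ}`. -/
def GammaK (K : ℕ) : Set Heis :=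
  {g | ∃ x y z : ℤ, g = ((x : ℝ), (y : ℝ), (z : ℝ) / K)}

/-- The flow generated by the left-invariant vector field associated to `U`:
`m ↦ m * exp (t U)`. -/
def hflow (U : ℝ × ℝ × ℝ) (t : ℝ) (m : Heis) : Heis := hmul m (hexp (t • U))

/-- The action of the left-invariant vector field associated to `U` on functions. -/
def VF (U : ℝ × ℝ × ℝ) (h : Heis → ℂ) (m : Heis) : ℂ :=
  deriv (fun t : ℝ => h (hflow U t m)) 0

/-- `C^∞(M)`: smooth `Γ_K`-invariant functions on `ℍ` (functions on `M = Γ_K\ℍ`). -/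
def SmoothM (K : ℕ) (h : Heis → ℂ) : Prop :=
  ContDiff ℝ (⊤ : ℕ∞) h ∧ ∀ γ ∈ GammaK K, ∀ m : Heis, h (hmul γ m) = h m

/-- `C^q(M)`: `C^q` `Γ_K`-invariant functions on `ℍ`. -/
def CqM (K : ℕ) (q : ℕ) (g : Heis → ℂ) : Prop :=
  ContDiff ℝ q g ∧ ∀ γ ∈ GammaK K, ∀ m : Heis, g (hmul γ m) = g m

/-- `C^∞_N = {h ∈ C^∞(M) : Z h = 2πiNK·h}`. -/
def CN (K : ℕ) (N : ℤ) (h : Heis → ℂ) : Prop :=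
  SmoothM K h ∧ VF Zvec h = fun m => (2 * Real.pi * Complex.I * N * K) * h m

/-- The `C^r` norm `‖f‖_{C^r} = sup_{k ≤ r} 2^{r-k} sup |f^{(k)}|` of a function on `ℝ`. -/
def CrNorm (r : ℕ) (η : ℝ → ℂ) : ℝ :=
  ⨆ k : Fin (r + 1), (2 : ℝ) ^ (r - (k : ℕ)) * ⨆ t : ℝ, ‖iteratedDeriv (k : ℕ) η t‖

/-- The `C^r` norm of a function on `M`. -/
def MCrNorm (r : ℕ) (g : Heis → ℂ) : ℝ :=
  ⨆ k : Fin (r + 1), (2 : ℝ) ^ (r - (k : ℕ)) * ⨆ m : Heis, ‖iteratedFDeriv ℝ (k : ℕ) g m‖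

/-- Test functions: `C^∞` functions with support compactly contained in `(-δ, δ)`. -/
def TestFun (δ : ℝ) (η : ℝ → ℂ) : Prop :=
  ContDiff ℝ (⊤ : ℕ∞) η ∧ HasCompactSupport η ∧ tsupport η ⊆ Set.Ioo (-δ) δ

/-- The linear functional `ℓ_{η,m}(h) = ∫_{-δ}^{δ} η(t)·h(φ_t^W(m)) dt`. -/
def ell (Wd : ℝ × ℝ × ℝ) (δ : ℝ) (η : ℝ → ℂ) (m : Heis) (h : Heis → ℂ) : ℂ :=
  ∫ t in (-δ)..δ, η t * h (hflow Wd t m)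

/-- The seminorm `|h|_{j,q}`. -/
def semiNorm (Vd Wd : ℝ × ℝ × ℝ) (δ : ℝ) (j q : ℕ) (h : Heis → ℂ) : ℝ :=
  sSup {x : ℝ | ∃ m : Heis, ∃ η : ℝ → ℂ, TestFun δ η ∧ CrNorm q η ≤ 1 ∧
    x = ‖ell Wd δ η m ((VF Vd)^[j] h)‖}

/-- The anisotropic norm `‖h‖_{p,q}`. -/
def pqNorm (Vd Wd : ℝ × ℝ × ℝ) (δ : ℝ) (p q : ℕ) (h : Heis → ℂ) : ℝ :=
  sSup {x : ℝ | ∃ j : ℕ, j ≤ p ∧ ∃ m : Heis, ∃ η : ℝ → ℂ, TestFun δ η ∧ CrNorm q η ≤ 1 ∧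
    x = ‖ell Wd δ η m ((VF Vd)^[j] h)‖}

/-- Integration over `M = Γ_K\ℍ` with respect to the probability measure `ν`
inherited from the Haar measure, computed on the fundamental domain
`[0,1) × [0,1) × [0,1/K)` (rescaled by `K` to have total mass one). -/
def nuInt (K : ℕ) (f : Heis → ℂ) : ℂ :=
  (K : ℂ) * (∫ m in (Set.Icc (0 : ℝ) 1 ×ˢ (Set.Icc (0 : ℝ) 1 ×ˢ Set.Icc (0 : ℝ) (1 / K))), f m)

/-- The setting of the paper: a Heisenberg nilmanifold `M = Γ_K\ℍ`, a partially
hyperbolic automorphism `Φ` with `Φ_* V = λ⁻¹ V`, `Φ_* W = λ W`, `Φ_* Z = Z` for a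
Heisenberg frame `{V, W, Z}`, and a fixed small `δ > 0`. -/
structure NilSetting where
  K : ℕ
  hK : 0 < K
  lam : ℝ
  hlam : 1 < lam
  Vd : ℝ × ℝ × ℝ
  Wd : ℝ × ℝ × ℝ
  frame : hbracket Vd Wd = Zvec
  Φ : Heis → Heis
  Φbij : Function.Bijective Φ
  Φhom : ∀ g g' : Heis, Φ (hmul g g') = hmul (Φ g) (Φ g')
  Φlattice : Φ '' GammaK K = GammaK K
  ΦV : ∀ t : ℝ, Φ (hexp (t • Vd)) = hexp ((lam⁻¹ * t) • Vd)
  ΦW : ∀ t : ℝ, Φ (hexp (t • Wd)) = hexp ((lam * t) • Wd)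
  ΦZ : ∀ t : ℝ, Φ (hexp (t • Zvec)) = hexp (t • Zvec)
  δ : ℝ
  hδ : 0 < δ

namespace NilSetting

/-- The transfer operator `L : h ↦ h ∘ Φ`. -/
def L (S : NilSetting) (h : Heis → ℂ) : Heis → ℂ := fun m => h (S.Φ m)

/-- The space `C^∞_N` as a set of functions. -/
def cn (S : NilSetting) (N : ℤ) : Set (Heis → ℂ) := {h | CN S.K N h}

/-- The anisotropic norm `‖·‖_{p,q}` of the setting. -/
def nrm (S : NilSetting) (p q : ℕ) (h : Heis → ℂ) : ℝ := pqNorm S.Vd S.Wd S.δ p q h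

/-- The seminorm `|·|_{j,q}` of the setting. -/
def snrm (S : NilSetting) (j q : ℕ) (h : Heis → ℂ) : ℝ := semiNorm S.Vd S.Wd S.δ j q h

end NilSetting

/-- `(B, j)` is a realisation of the completion of `Sset` with respect to the
norm `Nrm`: `j` is linear and isometric on `Sset` and has dense image. -/
def IsCompletion (Nrm : (Heis → ℂ) → ℝ) (Sset : Set (Heis → ℂ))
    {B : Type} [NormedAddCommGroup B] [NormedSpace ℂ B] (j : (Heis → ℂ) → B) : Prop :=
  CompleteSpace B ∧
  (∀ h ∈ Sset, ∀ h' ∈ Sset, j (h + h') = j h + j h') ∧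
  (∀ (c : ℂ), ∀ h ∈ Sset, j (c • h) = c • j h) ∧
  (∀ h ∈ Sset, ‖j h‖ = Nrm h) ∧
  Dense (j '' Sset)

open Set

lemma hflow_add (U : ℝ × ℝ × ℝ) (s t : ℝ) (m : Heis) :
    hflow U t (hflow U s m) = hflow U (s + t) m := by
  simp only [hflow, hmul, hexp, Prod.smul_fst, Prod.smul_snd, smul_eq_mul, Prod.mk.injEq]
  refine ⟨by ring, by ring, by ring⟩

lemma hflow_zero (U : ℝ × ℝ × ℝ) (m : Heis) : hflow U 0 m = m := by
  simp [hflow, hmul, hexp]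

lemma hflow_Zvec_comm (U : ℝ × ℝ × ℝ) (s c : ℝ) (m : Heis) :
    hflow U s (hflow Zvec c m) = hflow Zvec c (hflow U s m) := by
  simp only [hflow, hmul, hexp, Zvec, Prod.smul_fst, Prod.smul_snd, smul_eq_mul, Prod.mk.injEq]
  refine ⟨by ring, by ring, by ring⟩

lemma hflow_comm_of_hbracket_eq {U U' : ℝ × ℝ × ℝ} (hU : hbracket U U' = Zvec)
    (s t : ℝ) (m : Heis) :
    hflow U' t (hflow U s m) = hflow Zvec (s * t) (hflow U s (hflow U' t m)) := by
  have h1 : U.1 * U'.2.1 - U'.1 * U.2.1 = 1 := by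
    simpa [hbracket, Zvec] using hU
  simp only [hflow, hmul, hexp, Zvec, Prod.smul_fst, Prod.smul_snd, smul_eq_mul, Prod.mk.injEq]
  refine ⟨by ring, by ring, ?_⟩
  linear_combination (s * t) * h1

lemma hflow_hmul (U : ℝ × ℝ × ℝ) (t : ℝ) (g m : Heis) :
    hflow U t (hmul g m) = hmul g (hflow U t m) := by
  simp only [hflow, hmul, hexp, Prod.smul_fst, Prod.smul_snd, smul_eq_mul, Prod.mk.injEq]
  refine ⟨by ring, by ring, by ring⟩

lemma continuous_hflow (U : ℝ × ℝ × ℝ) : Continuous fun p : ℝ × Heis => hflow U p.1 p.2 := by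
  simp only [hflow, hmul, hexp, Prod.smul_fst, Prod.smul_snd, smul_eq_mul]
  fun_prop

lemma hasDerivAt_hflow_zero (U : ℝ × ℝ × ℝ) (m : Heis) :
    HasDerivAt (fun t => hflow U t m) (U.1, U.2.1, U.2.2 + m.1 * U.2.1) 0 := by
  simp only [hflow, hmul, hexp, Prod.smul_fst, Prod.smul_snd, smul_eq_mul]
  have hlin : ∀ u : ℝ, HasDerivAt (fun t : ℝ => t * u) u 0 := fun u => by
    simpa using (hasDerivAt_id (0 : ℝ)).mul_const u
  refine ((hlin U.1).const_add m.1).prodMk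
    (((hlin U.2.1).const_add m.2.1).prodMk ?_)
  exact ((((hlin U.2.2).fun_add (((hlin U.1).fun_mul (hlin U.2.1)).div_const 2)).const_add
    m.2.2).fun_add ((hlin U.2.1).const_mul m.1)).congr_deriv (by simp)

section Derivative

variable {h : Heis → ℂ}

lemma hasDerivAt_comp_hflow (hh : Differentiable ℝ h) (U : ℝ × ℝ × ℝ) (m : Heis) (s : ℝ) :
    HasDerivAt (fun t => h (hflow U t m)) (VF U h (hflow U s m)) s := by
  have hd : DifferentiableAt ℝ (fun t : ℝ => h (hflow U t (hflow U s m))) 0 :=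
    (hh _).comp (0 : ℝ) (hasDerivAt_hflow_zero U (hflow U s m)).differentiableAt
  have h0 : HasDerivAt (fun t : ℝ => h (hflow U t (hflow U s m)))
      (VF U h (hflow U s m)) (s - s) := by
    rw [sub_self]
    exact hd.hasDerivAt
  have h1 := h0.comp_sub_const s s
  simpa [hflow_add] using h1

lemma VF_eq_fderiv (hh : Differentiable ℝ h) (U : ℝ × ℝ × ℝ) (m : Heis) :
    VF U h m = fderiv ℝ h m (U.1, U.2.1, U.2.2 + m.1 * U.2.1) := by
  have hd : HasFDerivAt h (fderiv ℝ h m) (hflow U 0 m) := by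
    rw [hflow_zero]
    exact (hh m).hasFDerivAt
  exact (hd.comp_hasDerivAt (0 : ℝ) (hasDerivAt_hflow_zero U m)).deriv

lemma continuous_VF (hh : ContDiff ℝ 1 h) (U : ℝ × ℝ × ℝ) : Continuous (VF U h) := by
  have heq : VF U h = fun m => fderiv ℝ h m (U.1, U.2.1, U.2.2 + m.1 * U.2.1) :=
    funext (VF_eq_fderiv (hh.differentiable one_ne_zero) U)
  rw [heq]
  exact (hh.continuous_fderiv one_ne_zero).clm_apply (by fun_prop)

lemma VF_hmul {K : ℕ} (hinv : ∀ γ ∈ GammaK K, ∀ m, h (hmul γ m) = h m) (U : ℝ × ℝ × ℝ) :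
    ∀ γ ∈ GammaK K, ∀ m, VF U h (hmul γ m) = VF U h m := by
  intro γ hγ m
  simp only [VF, hflow_hmul, hinv γ hγ]

/-- Along the central flow, a solution of `Zh = θh` is multiplied by the character of `θ`. -/
lemma comp_hflow_Zvec {θ : ℂ} (hh : Differentiable ℝ h) (hZ : ∀ m, VF Zvec h m = θ * h m)
    (c : ℝ) (m : Heis) : h (hflow Zvec c m) = Complex.exp (θ * c) * h m := by
  have hder : ∀ s : ℝ, HasDerivAt (fun s : ℝ => Complex.exp (-θ * s) * h (hflow Zvec s m)) 0 s := by
    intro s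
    have he : HasDerivAt (fun s : ℝ => Complex.exp (-θ * s)) (Complex.exp (-θ * s) * -θ) s := by
      have := ((hasDerivAt_id (s : ℂ)).const_mul (-θ)).cexp.comp_ofReal
      simpa using this
    refine (he.fun_mul (hasDerivAt_comp_hflow hh Zvec m s)).congr_deriv ?_
    rw [hZ]
    ring
  have hconst := is_const_of_deriv_eq_zero (fun s => (hder s).differentiableAt)
    (fun s => (hder s).deriv) c 0
  simp only [hflow_zero, Complex.ofReal_zero, mul_zero, Complex.exp_zero, one_mul] at hconst
  rw [← hconst, ← mul_assoc, ← Complex.exp_add]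
  simp

lemma VF_comp_hflow_Zvec {c : ℝ} {w : ℂ} (hw : ∀ m, h (hflow Zvec c m) = w * h m)
    (U : ℝ × ℝ × ℝ) (m : Heis) : VF U h (hflow Zvec c m) = w * VF U h m := by
  simp only [VF, hflow_Zvec_comm, hw]
  exact deriv_const_mul_field w

end Derivative

/-- The unit cube meets every orbit of the lattice. -/
lemma exists_GammaK_hmul_mem {K : ℕ} (hK : 0 < K) (m : Heis) :
    ∃ γ ∈ GammaK K, hmul γ m ∈ Icc (0 : ℝ) 1 ×ˢ (Icc (0 : ℝ) 1 ×ˢ Icc (0 : ℝ) 1) := by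
  have hK' : (1 : ℝ) ≤ K := by exact_mod_cast hK
  have hK0 : (0 : ℝ) < K := by linarith
  set r : ℝ := m.2.2 + (-⌊m.1⌋ : ℤ) * m.2.1 with hr
  refine ⟨_, ⟨-⌊m.1⌋, -⌊m.2.1⌋, -⌊K * r⌋, rfl⟩, ?_⟩
  have h3 : ((-⌊K * r⌋ : ℤ) : ℝ) / K + m.2.2 + ((-⌊m.1⌋ : ℤ) : ℝ) * m.2.1
      = Int.fract (K * r) / K := by
    rw [← Int.self_sub_floor, sub_div, mul_div_cancel_left₀ _ hK0.ne', hr]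
    push_cast
    ring
  simp only [hmul, mem_prod, mem_Icc]
  rw [h3]
  have h1 : ((-⌊m.1⌋ : ℤ) : ℝ) + m.1 = Int.fract m.1 := by
    rw [← Int.self_sub_floor]; push_cast; ring
  have h2 : ((-⌊m.2.1⌋ : ℤ) : ℝ) + m.2.1 = Int.fract m.2.1 := by
    rw [← Int.self_sub_floor]; push_cast; ring
  rw [h1, h2]
  refine ⟨⟨Int.fract_nonneg _, (Int.fract_lt_one _).le⟩,
    ⟨Int.fract_nonneg _, (Int.fract_lt_one _).le⟩,
    div_nonneg (Int.fract_nonneg _) hK0.le, ?_⟩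
  rw [div_le_one hK0]
  exact (Int.fract_lt_one _).le.trans hK'

lemma exists_norm_le_of_GammaK_invariant {K : ℕ} (hK : 0 < K) {u : Heis → ℂ}
    (hu : Continuous u) (hinv : ∀ γ ∈ GammaK K, ∀ m, u (hmul γ m) = u m) :
    ∃ B : ℝ, ∀ m, ‖u m‖ ≤ B := by
  have hcomp : IsCompact (Icc (0 : ℝ) 1 ×ˢ (Icc (0 : ℝ) 1 ×ˢ Icc (0 : ℝ) 1)) :=
    isCompact_Icc.prod (isCompact_Icc.prod isCompact_Icc)
  obtain ⟨B, hB⟩ := hcomp.exists_bound_of_continuousOn hu.continuousOn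
  refine ⟨B, fun m => ?_⟩
  obtain ⟨γ, hγ, hm⟩ := exists_GammaK_hmul_mem hK m
  rw [← hinv γ hγ m]
  exact hB _ hm

section TestFunctions

variable {δ : ℝ} {η : ℝ → ℂ}

lemma TestFun.deriv (hη : TestFun δ η) : TestFun δ (deriv η) :=
  ⟨(contDiff_infty_iff_deriv.1 hη.1).2, hη.2.1.deriv, tsupport_deriv_subset.trans hη.2.2⟩

lemma TestFun.mul_left (hη : TestFun δ η) {f : ℝ → ℂ} (hf : ContDiff ℝ (⊤ : ℕ∞) f) :
    TestFun δ (fun t => f t * η t) :=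
  ⟨hf.mul hη.1, hη.2.1.mul_left, (tsupport_mul_subset_right (f := f)).trans hη.2.2⟩

lemma TestFun.iteratedDeriv (hη : TestFun δ η) (k : ℕ) : TestFun δ (iteratedDeriv k η) := by
  induction k with
  | zero => simpa using hη
  | succ k ih => rw [iteratedDeriv_succ]; exact ih.deriv

lemma TestFun.eq_zero_of_notMem (hη : TestFun δ η) {t : ℝ} (ht : t ∉ Ioo (-δ) δ) : η t = 0 :=
  image_eq_zero_of_notMem_tsupport fun h => ht (hη.2.2 h)

lemma TestFun.norm_iteratedDeriv_le (hη : TestFun δ η) {k r : ℕ} (hk : k ≤ r) (t : ℝ) :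
    ‖_root_.iteratedDeriv k η t‖ ≤ CrNorm r η := by
  obtain ⟨B, hB⟩ := (hη.iteratedDeriv k).2.1.exists_bound_of_continuous
    (hη.iteratedDeriv k).1.continuous
  have h1 : ‖_root_.iteratedDeriv k η t‖ ≤ ⨆ t : ℝ, ‖_root_.iteratedDeriv k η t‖ :=
    le_ciSup (f := fun t : ℝ => ‖_root_.iteratedDeriv k η t‖)
      ⟨B, by rintro _ ⟨t, rfl⟩; exact hB t⟩ t
  have h2 : (2 : ℝ) ^ (r - k) * ⨆ t : ℝ, ‖_root_.iteratedDeriv k η t‖ ≤ CrNorm r η :=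
    le_ciSup (f := fun k : Fin (r + 1) =>
      (2 : ℝ) ^ (r - (k : ℕ)) * ⨆ t : ℝ, ‖_root_.iteratedDeriv (k : ℕ) η t‖)
      (Set.finite_range _).bddAbove ⟨k, Nat.lt_succ_of_le hk⟩
  have h3 : (1 : ℝ) ≤ 2 ^ (r - k) := one_le_pow₀ one_le_two
  nlinarith [norm_nonneg (_root_.iteratedDeriv k η t)]

lemma CrNorm_le {r : ℕ} {B : ℝ}
    (hη : ∀ k ≤ r, ∀ t, ‖iteratedDeriv k η t‖ ≤ B) : CrNorm r η ≤ 2 ^ r * B := by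
  refine ciSup_le fun k => ?_
  have hk : (k : ℕ) ≤ r := Nat.le_of_lt_succ k.2
  exact mul_le_mul (pow_le_pow_right₀ one_le_two (Nat.sub_le r k)) (ciSup_le (hη k hk))
    (Real.iSup_nonneg fun _ => norm_nonneg _) (by positivity)

lemma CrNorm_const_mul (r : ℕ) (w : ℝ) (hw : 0 ≤ w) (η : ℝ → ℂ) :
    CrNorm r (fun t => (w : ℂ) * η t) = w * CrNorm r η := by
  simp only [CrNorm, iteratedDeriv_const_mul_field, norm_mul, Complex.norm_real,
    Real.norm_of_nonneg hw]
  simp only [← Real.mul_iSup_of_nonneg hw, mul_left_comm _ w]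

lemma contDiff_cexp_mul_ofReal (κ : ℂ) :
    ContDiff ℝ (⊤ : ℕ∞) fun t : ℝ => Complex.exp (κ * t) :=
  (contDiff_const.mul Complex.ofRealCLM.contDiff).cexp

lemma norm_iteratedDeriv_cexp_mul_le {κ : ℂ} (hκ : κ.re = 0) (k : ℕ) :
    ∀ {η : ℝ → ℂ} {B : ℝ}, ContDiff ℝ (⊤ : ℕ∞) η →
      (∀ j ≤ k, ∀ t, ‖iteratedDeriv j η t‖ ≤ B) →
      ∀ t, ‖iteratedDeriv k (fun t : ℝ => Complex.exp (κ * t) * η t) t‖ ≤ (1 + ‖κ‖) ^ k * B := by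
  induction k with
  | zero =>
    intro η B _ hB t
    have := hB 0 le_rfl t
    simpa [Complex.norm_exp, hκ] using this
  | succ k ih =>
    intro η B hη hB t
    have hη' := (contDiff_infty_iff_deriv.1 hη).2
    have hd : deriv (fun t : ℝ => Complex.exp (κ * t) * η t)
        = fun t : ℝ => Complex.exp (κ * t) * (κ * η t + deriv η t) := by
      funext s
      have he : HasDerivAt (fun s : ℝ => Complex.exp (κ * s)) (Complex.exp (κ * s) * κ) s := by
        have := ((hasDerivAt_id (s : ℂ)).const_mul κ).cexp.comp_ofReal
        simpa using this
      have hηd : HasDerivAt η (deriv η s) s :=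
        ((contDiff_infty_iff_deriv.1 hη).1 s).hasDerivAt
      rw [(he.fun_mul hηd).deriv]
      ring
    rw [iteratedDeriv_succ', hd, pow_succ, mul_assoc]
    refine ih (contDiff_const.mul hη |>.add hη') (fun j hj s => ?_) t
    have hadd : iteratedDeriv j (fun t => κ * η t + deriv η t) s
        = κ * iteratedDeriv j η s + iteratedDeriv (j + 1) η s := by
      have hle : ((j : ℕ∞) : WithTop ℕ∞) ≤ ((⊤ : ℕ∞) : WithTop ℕ∞) := by exact_mod_cast le_top
      have := iteratedDeriv_fun_add (n := j) (x := s) (f := fun t => κ * η t) (g := deriv η)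
        ((contDiff_const.mul hη).of_le hle).contDiffAt (hη'.of_le hle).contDiffAt
      rw [this, iteratedDeriv_const_mul_field, iteratedDeriv_succ']
    rw [hadd]
    calc ‖κ * iteratedDeriv j η s + iteratedDeriv (j + 1) η s‖
        ≤ ‖κ‖ * ‖iteratedDeriv j η s‖ + ‖iteratedDeriv (j + 1) η s‖ := by
          rw [← norm_mul]; exact norm_add_le _ _
      _ ≤ ‖κ‖ * B + B := by
          gcongr
          · exact hB j (by omega) s
          · exact hB (j + 1) (by omega) s
      _ = (1 + ‖κ‖) * B := by ring

lemma norm_iteratedDeriv_cexp_mul_le_of_CrNorm_le_one {q k : ℕ} (hη : TestFun δ η)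
    (hηq : CrNorm q η ≤ 1) {κ : ℂ} (hκ : κ.re = 0) {R : ℝ} (hR : ‖κ‖ ≤ R) (hk : k ≤ q) (t : ℝ) :
    ‖iteratedDeriv k (fun t : ℝ => Complex.exp (κ * t) * η t) t‖ ≤ (1 + R) ^ q := by
  have hR0 : 0 ≤ R := (norm_nonneg κ).trans hR
  calc _ ≤ (1 + ‖κ‖) ^ k * 1 := norm_iteratedDeriv_cexp_mul_le hκ k hη.1
        (fun j hj s => (hη.norm_iteratedDeriv_le (hj.trans hk) s).trans hηq) t
    _ ≤ (1 + R) ^ k := by rw [mul_one]; gcongr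
    _ ≤ (1 + R) ^ q := pow_le_pow_right₀ (by linarith) hk

end TestFunctions

/-- A mean value estimate for an integral depending on a parameter. -/
lemma norm_intervalIntegral_sub_le {F F' : ℝ → ℝ → ℂ} {α β A ε s : ℝ}
    (hF : ∀ t r, HasDerivAt (fun r => F r t) (F' r t) r)
    (hF' : Continuous fun p : ℝ × ℝ => F' p.1 p.2) (hFc : ∀ r, Continuous (F r))
    (hA : ∀ r, |r| ≤ ε → ‖∫ t in α..β, F' r t‖ ≤ A) (hs : |s| ≤ ε) :
    ‖(∫ t in α..β, F s t) - ∫ t in α..β, F 0 t‖ ≤ A * ε := by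
  have hA0 : 0 ≤ A := (norm_nonneg _).trans (hA s hs)
  have hdiff : (∫ t in α..β, F s t) - ∫ t in α..β, F 0 t
      = ∫ r in (0 : ℝ)..s, ∫ t in α..β, F' r t := by
    rw [← intervalIntegral.integral_sub ((hFc s).intervalIntegrable _ _)
      ((hFc 0).intervalIntegrable _ _), intervalIntegral_intervalIntegral_swap]
    · refine intervalIntegral.integral_congr fun t _ => ?_
      refine (intervalIntegral.integral_eq_sub_of_hasDerivAt (fun r _ => hF t r) ?_).symm
      exact (hF'.comp (Continuous.prodMk_left t)).intervalIntegrable _ _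
    · refine (hF'.continuousOn.integrableOn_compact
        (isCompact_uIcc.prod isCompact_uIcc)).mono_set
        (prod_mono uIoc_subset_uIcc uIoc_subset_uIcc)
  rw [hdiff]
  refine (intervalIntegral.norm_integral_le_of_norm_le_const (C := A) fun r hr => hA r ?_).trans ?_
  · have := abs_sub_left_of_mem_uIcc (uIoc_subset_uIcc hr)
    simp only [sub_zero] at this
    exact this.trans hs
  · rw [sub_zero]
    gcongr

lemma norm_ell_le {Wd : ℝ × ℝ × ℝ} {δ : ℝ} (hδ : 0 ≤ δ) {η : ℝ → ℂ} {u : Heis → ℂ} {A B : ℝ}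
    (hη : ∀ t, ‖η t‖ ≤ A) (hu : ∀ m, ‖u m‖ ≤ B) (m : Heis) :
    ‖ell Wd δ η m u‖ ≤ A * B * (2 * δ) := by
  refine (intervalIntegral.norm_integral_le_of_norm_le_const (C := A * B) fun t _ => ?_).trans ?_
  · rw [norm_mul]
    exact mul_le_mul (hη t) (hu _) (norm_nonneg _) ((norm_nonneg _).trans (hη t))
  · rw [abs_of_nonneg (by linarith)]
    exact le_of_eq (by ring)

/-- The integration by parts formula for `ell` along the flow direction. -/
lemma ell_VF_self {Wd : ℝ × ℝ × ℝ} {δ : ℝ} {η : ℝ → ℂ} (hη : TestFun δ η) {h : Heis → ℂ}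
    (hh : ContDiff ℝ 1 h) (m : Heis) :
    ell Wd δ η m (VF Wd h) = -ell Wd δ (deriv η) m h := by
  have hflowc : Continuous fun t : ℝ => hflow Wd t m :=
    (continuous_hflow Wd).comp (Continuous.prodMk_left m)
  have := intervalIntegral.integral_mul_deriv_eq_deriv_mul (a := -δ) (b := δ)
    (u := η) (u' := deriv η) (v := fun t => h (hflow Wd t m))
    (v' := fun t => VF Wd h (hflow Wd t m))
    (fun t _ => ((contDiff_infty_iff_deriv.1 hη.1).1 t).hasDerivAt)
    (fun t _ => hasDerivAt_comp_hflow (hh.differentiable one_ne_zero) Wd m t)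
    (hη.deriv.1.continuous.intervalIntegrable _ _)
    (((continuous_VF hh Wd).comp hflowc).intervalIntegrable _ _)
  rw [hη.eq_zero_of_notMem (by simp), hη.eq_zero_of_notMem (by simp)] at this
  simpa [ell] using this

/-- Conjugating the flow of `Wd` by the flow of `Vd` twists the test function. -/
lemma ell_cexp_mul_hflow {Vd Wd : ℝ × ℝ × ℝ} (hframe : hbracket Vd Wd = Zvec) {θ : ℂ}
    {u : Heis → ℂ} (hu : ∀ (c : ℝ) (m : Heis), u (hflow Zvec c m) = Complex.exp (θ * c) * u m)
    (δ : ℝ) (η : ℝ → ℂ) (s : ℝ) (m : Heis) :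
    ell Wd δ (fun t : ℝ => Complex.exp (-(θ * s) * t) * η t) (hflow Vd s m) u
      = ∫ t in (-δ)..δ, η t * u (hflow Vd s (hflow Wd t m)) := by
  refine intervalIntegral.integral_congr fun t _ => ?_
  simp only [hflow_comm_of_hbracket_eq hframe, hu]
  have : Complex.exp (-(θ * s) * t) * Complex.exp (θ * (s * t : ℝ)) = 1 := by
    rw [← Complex.exp_add]
    push_cast
    ring_nf
    exact Complex.exp_zero
  linear_combination (η t * u (hflow Vd s (hflow Wd t m))) * this

section Norm

variable {K : ℕ} {N : ℤ} {h : Heis → ℂ} {δ : ℝ} {Vd Wd : ℝ × ℝ × ℝ}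

lemma CN.contDiff_one (hh : CN K N h) : ContDiff ℝ 1 h := hh.1.1.of_le (by exact_mod_cast le_top)

lemma CN.exists_norm_iterate_VF_le (hh : CN K N h) (hK : 0 < K) (Vd : ℝ × ℝ × ℝ) :
    ∃ B : ℝ, ∀ j ≤ 1, ∀ m, ‖(VF Vd)^[j] h m‖ ≤ B := by
  obtain ⟨B, hB⟩ := exists_norm_le_of_GammaK_invariant hK hh.1.1.continuous hh.1.2
  obtain ⟨B', hB'⟩ := exists_norm_le_of_GammaK_invariant hK (continuous_VF hh.contDiff_one Vd)
    (VF_hmul hh.1.2 Vd)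
  refine ⟨max B B', fun j hj m => ?_⟩
  interval_cases j
  · exact (hB m).trans (le_max_left _ _)
  · exact (hB' m).trans (le_max_right _ _)

lemma norm_ell_iterate_VF_le_mul_pqNorm (hh : CN K N h) (hK : 0 < K) (hδ : 0 ≤ δ) {r j : ℕ}
    (hj : j ≤ 1) {η : ℝ → ℂ} (hη : TestFun δ η) {A : ℝ} (hA : 0 < A) (hηA : CrNorm r η ≤ A)
    (m : Heis) :
    ‖ell Wd δ η m ((VF Vd)^[j] h)‖ ≤ A * pqNorm Vd Wd δ 1 r h := by
  obtain ⟨B, hB⟩ := hh.exists_norm_iterate_VF_le hK Vd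
  have hscale : ell Wd δ (fun t => ((A⁻¹ : ℝ) : ℂ) * η t) m ((VF Vd)^[j] h)
      = ((A⁻¹ : ℝ) : ℂ) * ell Wd δ η m ((VF Vd)^[j] h) := by
    simp only [ell, mul_assoc, intervalIntegral.integral_const_mul]
  have hle : ‖ell Wd δ (fun t => ((A⁻¹ : ℝ) : ℂ) * η t) m ((VF Vd)^[j] h)‖
      ≤ pqNorm Vd Wd δ 1 r h := by
    refine le_csSup ⟨1 * B * (2 * δ), ?_⟩ ⟨j, hj, m, _, hη.mul_left contDiff_const, ?_, rfl⟩
    · rintro _ ⟨i, hi, m', ζ, hζ, hζr, rfl⟩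
      refine norm_ell_le hδ (fun t => ?_) (hB i hi) m'
      simpa using (hζ.norm_iteratedDeriv_le (Nat.zero_le r) t).trans hζr
    · rw [CrNorm_const_mul r _ (by positivity), inv_mul_le_one₀ hA]
      exact hηA
  rw [hscale, norm_mul, Complex.norm_real, Real.norm_of_nonneg (by positivity),
    inv_mul_le_iff₀ hA] at hle
  exact hle

end Norm

/-- **Lemma 2.2 (sliding).** Fix `q ∈ ℕ` and `0 < ε < δ`. There exists `C > 0` such
that for all `m ∈ M`, `η ∈ C_c^∞((-δ,δ))` with `‖η‖_{C^q} ≤ 1`, and `a, b, c ∈ ℝ`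
with `|a|, |b| ≤ ε`, setting `m̃ = φ_c^Z(φ_b^W(φ_a^V(m)))` and
`η̃(t) = e^{-2πiNK(c+at)} η(t)`, one has
`|ℓ_{η,m}(h) - ℓ_{η̃,m̃}(h)| ≤ C ε ‖h‖_{1,q-1}` for all `h ∈ C^∞_N`. -/
theorem slide (S : NilSetting) (N : ℤ) (q : ℕ) (hq : 1 ≤ q)
    (ε : ℝ) (hε : 0 < ε) (hεδ : ε < S.δ) :
    ∃ C : ℝ, 0 < C ∧
      ∀ (m : Heis) (η : ℝ → ℂ), TestFun S.δ η → CrNorm q η ≤ 1 →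
        ∀ a b c : ℝ, |a| ≤ ε → |b| ≤ ε →
          ∀ h ∈ S.cn N,
            ‖ell S.Wd S.δ η m h -
              ell S.Wd S.δ
                (fun t => Complex.exp (-(2 * Real.pi * Complex.I * N * S.K) * ((c + a * t : ℝ) : ℂ)) * η t)
                (hflow Zvec c (hflow S.Wd b (hflow S.Vd a m))) h‖ ≤
              C * ε * S.nrm 1 (q - 1) h := by
  obtain ⟨q, rfl⟩ : ∃ r, q = r + 1 := ⟨q - 1, by omega⟩
  rw [Nat.add_sub_cancel]
  have hδ := S.hδ
  set θ : ℂ := 2 * Real.pi * Complex.I * N * S.K with hθ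
  have hθre : θ.re = 0 := by simp [hθ]
  set R : ℝ := ‖θ‖ * ε with hR
  have hR0 : 0 ≤ R := by positivity
  set A : ℝ := 2 ^ q * (1 + R) ^ (q + 1) with hAdef
  have hA : 0 < A := by positivity
  refine ⟨2 * A, by positivity, fun m η hη hηq a b c ha hb h (hh : CN S.K N h) => ?_⟩
  have hh1 := hh.contDiff_one
  have hhd := hh1.differentiable one_ne_zero
  have hZ : ∀ (c : ℝ) (m : Heis), h (hflow Zvec c m) = Complex.exp (θ * c) * h m :=
    comp_hflow_Zvec hhd (congrFun hh.2)
  have hZV : ∀ (c : ℝ) (m : Heis),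
      VF S.Vd h (hflow Zvec c m) = Complex.exp (θ * c) * VF S.Vd h m :=
    fun c => VF_comp_hflow_Zvec (hZ c) S.Vd
  let tw : ℝ → ℝ → ℂ := fun s t => Complex.exp (-(θ * s) * t) * η t
  have htw : ∀ s, TestFun S.δ (tw s) := fun s => hη.mul_left (contDiff_cexp_mul_ofReal _)
  have htwd : ∀ s, |s| ≤ ε → ∀ k ≤ q + 1, ∀ t, ‖iteratedDeriv k (tw s) t‖ ≤ (1 + R) ^ (q + 1) := by
    intro s hs k hk t
    refine norm_iteratedDeriv_cexp_mul_le_of_CrNorm_le_one hη hηq (by simp [hθre]) ?_ hk t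
    rw [norm_neg, norm_mul, Complex.norm_real, Real.norm_eq_abs, hR]
    gcongr
  have hcont : ∀ (U : ℝ × ℝ × ℝ) (x : Heis), Continuous fun t : ℝ => hflow U t x := fun U x =>
    (continuous_hflow U).comp (Continuous.prodMk_left x)
  -- Slide along `Vd`.
  have hV : ‖ell S.Wd S.δ (tw a) (hflow S.Vd a m) h - ell S.Wd S.δ η m h‖
      ≤ A * S.nrm 1 q h * ε := by
    have hflows : Continuous fun p : ℝ × ℝ => hflow S.Vd p.1 (hflow S.Wd p.2 m) :=
      (continuous_hflow S.Vd).comp (continuous_fst.prodMk ((hcont S.Wd m).comp continuous_snd))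
    have hmv := norm_intervalIntegral_sub_le (α := -S.δ) (β := S.δ) (A := A * S.nrm 1 q h)
      (F := fun s t => η t * h (hflow S.Vd s (hflow S.Wd t m)))
      (F' := fun s t => η t * VF S.Vd h (hflow S.Vd s (hflow S.Wd t m)))
      (fun t r => (hasDerivAt_comp_hflow hhd S.Vd _ r).const_mul (η t))
      ((hη.1.continuous.comp continuous_snd).mul ((continuous_VF hh1 S.Vd).comp hflows))
      (fun r => hη.1.continuous.mul
        (hh.1.1.continuous.comp (hflows.comp (Continuous.prodMk_right r))))
      (fun r hr => ?_) ha
    · rw [← ell_cexp_mul_hflow S.frame hZ] at hmv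
      simp only [hflow_zero] at hmv
      exact hmv
    · rw [← ell_cexp_mul_hflow S.frame hZV]
      exact norm_ell_iterate_VF_le_mul_pqNorm (j := 1) hh S.hK hδ.le le_rfl (htw r) hA
        (CrNorm_le fun k hk => htwd r hr k (by omega)) _
  -- Slide along `Wd`.
  have hW : ‖ell S.Wd S.δ (tw a) (hflow S.Wd b (hflow S.Vd a m)) h
      - ell S.Wd S.δ (tw a) (hflow S.Vd a m) h‖ ≤ A * S.nrm 1 q h * ε := by
    have hflows : Continuous fun p : ℝ × ℝ => hflow S.Wd (p.1 + p.2) (hflow S.Vd a m) :=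
      (hcont S.Wd _).comp (continuous_fst.add continuous_snd)
    have hmv := norm_intervalIntegral_sub_le (α := -S.δ) (β := S.δ) (A := A * S.nrm 1 q h)
      (F := fun s t => tw a t * h (hflow S.Wd (s + t) (hflow S.Vd a m)))
      (F' := fun s t => tw a t * VF S.Wd h (hflow S.Wd (s + t) (hflow S.Vd a m)))
      (fun t r => ((hasDerivAt_comp_hflow hhd S.Wd _ (r + t)).comp_add_const r t).const_mul
        (tw a t))
      (((htw a).1.continuous.comp continuous_snd).mul ((continuous_VF hh1 S.Wd).comp hflows))
      (fun r => (htw a).1.continuous.mul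
        (hh.1.1.continuous.comp (hflows.comp (Continuous.prodMk_right r))))
      (fun r hr => ?_) hb
    · simpa only [ell, hflow_add, zero_add] using hmv
    · simp only [← hflow_add]
      change ‖ell S.Wd S.δ (tw a) (hflow S.Wd r (hflow S.Vd a m)) (VF S.Wd h)‖ ≤ _
      rw [ell_VF_self (htw a) hh1, norm_neg]
      refine norm_ell_iterate_VF_le_mul_pqNorm (j := 0) hh S.hK hδ.le zero_le_one (htw a).deriv hA
        (CrNorm_le fun k hk t => ?_) _
      rw [← iteratedDeriv_succ']
      exact htwd a ha (k + 1) (by omega) t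
  have hfinal : ell S.Wd S.δ (fun t => Complex.exp (-θ * ((c + a * t : ℝ) : ℂ)) * η t)
      (hflow Zvec c (hflow S.Wd b (hflow S.Vd a m))) h
      = ell S.Wd S.δ (tw a) (hflow S.Wd b (hflow S.Vd a m)) h := by
    refine intervalIntegral.integral_congr fun t _ => ?_
    simp only [tw, hflow_Zvec_comm S.Wd, hZ]
    have : Complex.exp (-θ * ((c + a * t : ℝ) : ℂ)) * Complex.exp (θ * c)
        = Complex.exp (-(θ * a) * t) := by
      rw [← Complex.exp_add]
      push_cast
      ring_nf
    linear_combination (η t * h (hflow S.Wd t (hflow S.Wd b (hflow S.Vd a m)))) * this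
  rw [hfinal, norm_sub_rev]
  calc _ ≤ _ := norm_sub_le_norm_sub_add_norm_sub _
        (ell S.Wd S.δ (tw a) (hflow S.Vd a m) h) _
    _ ≤ A * S.nrm 1 q h * ε + A * S.nrm 1 q h * ε := add_le_add hW hV
    _ = 2 * A * ε * S.nrm 1 q h := by ring
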